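/- Let q be an integer greater than 1. For j = 1, 2, let 𝒯_j = (V_j, ℰ_j) be a leafless, locally finite rooted directed tree and let S^{(j)}_{λ,q} be the Dirichlet shift on ℓ²(V_j). Then there exists a unitary operator U : ℓ²(V_1) → ℓ²(V_2) with U S^{(1)}_{λ,q} = S^{(2)}_{λ,q} U if and only if for every n ∈ ℕ, Σ_{v∈V^{(1)}_≺, n_v = n} (card Chi(v) − 1) = Σ_{v∈V^{(2)}_≺, n_v = n} (card Chi(v) − 1), where V^{(j)}_≺ denotes the set of branching vertices of 𝒯_j and the sums (which are finite since the trees are locally finite) range over the branching vertices of depth n. -/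

import Mathlib

open scoped ENNReal InnerProductSpace
open ContinuousLinearMap

noncomputable section

/-- A (countably infinite) rooted directed tree. -/
structure DirTree (V : Type) where
  edge : V → V → Prop
  not_self : ∀ v, ¬ edge v v
  no_circuit : ∀ v, ¬ Relation.TransGen edge v v
  connected : ∀ u v : V, Relation.ReflTransGen (fun a b => edge a b ∨ edge b a) u v
  uniq_parent : ∀ {u w v : V}, edge u v → edge w v → u = w
  root : V
  root_no_parent : ∀ u, ¬ edge u root
  root_uniq : ∀ v, (∀ u, ¬ edge u v) → v = root

namespace DirTree

variable {V : Type} (T : DirTree V)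

/-- The set of children of a vertex. -/
def chi (v : V) : Set V := {u | T.edge v u}

/-- Leafless: every vertex has a child. -/
def Leafless : Prop := ∀ v : V, ∃ u, T.edge v u

/-- Locally finite: every vertex has finitely many children. -/
def LocFin : Prop := ∀ v : V, (T.chi v).Finite

/-- The finset of children of a vertex (locally finite case). -/
def chiFin (hT : T.LocFin) (v : V) : Finset V := (hT v).toFinset

/-- Iterated child sets `Chi^⟨n⟩(W)`. -/
def chiIter (T : DirTree V) : ℕ → Set V → Set V
  | 0, W => W
  | n + 1, W => {u | ∃ v ∈ chiIter T n W, T.edge v u}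

/-- The depth of a vertex: the unique `n` with `v ∈ Chi^⟨n⟩(root)`. -/
def depth (v : V) : ℕ := sInf {n | v ∈ T.chiIter n {T.root}}

/-- The parent map (junk value at the root). -/
def par (v : V) : V :=
  letI := Classical.propDecidable (∃ u, T.edge u v)
  if h : ∃ u, T.edge u v then h.choose else v

end DirTree

/-- `ℓ²(V)`. -/
abbrev l2 (V : Type) := lp (fun _ : V => ℂ) 2

/-- The standard orthonormal basis vector `e_v` of `ℓ²(V)`. -/
def evec {V : Type} (v : V) : l2 V :=
  letI := Classical.decEq V
  lp.single 2 v 1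

/-- The Pochhammer symbol `(x)_k = x (x+1) ⋯ (x+k-1)`. -/
def poch (x : ℝ) (k : ℕ) : ℝ := ∏ i ∈ Finset.range k, (x + i)

namespace DirTree

variable {V : Type} (T : DirTree V)

/-- The weight `λ_{u,q}` (for any child `u` of `v`). -/
def wt (hT : T.LocFin) (q : ℝ) (v : V) : ℝ :=
  Real.sqrt (((T.depth v : ℝ) + q) / ((T.depth v : ℝ) + 1)) /
    Real.sqrt ((T.chiFin hT v).card)

/-- `S` is the Dirichlet shift with parameter `q` on `ℓ²(V)`:
`S e_v = ∑_{u ∈ Chi(v)} λ_{u,q} e_u`. -/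
def IsDirichletShift (hT : T.LocFin) (q : ℝ) (S : l2 V →L[ℂ] l2 V) : Prop :=
  ∀ v : V, S (evec v) = ∑ u ∈ T.chiFin hT v, ((T.wt hT q v : ℝ) : ℂ) • evec u

end DirTree

/-- The Cauchy dual `S (S*S)⁻¹` of a left-invertible operator. -/
def cauchyDual {V : Type} (S : l2 V →L[ℂ] l2 V) : l2 V →L[ℂ] l2 V :=
  S * Ring.inverse (ContinuousLinearMap.adjoint S * S)

/-! ### Levels of a rooted tree -/

namespace DirTree

variable {V : Type} (T : DirTree V)

theorem exists_mem_chiIter (v : V) : ∃ n, v ∈ T.chiIter n {T.root} := by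
  induction T.connected T.root v with
  | refl => exact ⟨0, rfl⟩
  | @tail b c _ hbc ih =>
    obtain ⟨n, hn⟩ := ih
    rcases hbc with h | h
    · exact ⟨n + 1, b, hn, h⟩
    · cases n with
      | zero =>
        obtain rfl : b = T.root := hn
        exact absurd h (T.root_no_parent c)
      | succ n =>
        obtain ⟨w, hw, hwb⟩ := hn
        obtain rfl := T.uniq_parent hwb h
        exact ⟨n, hw⟩

theorem chiIter_unique {m n : ℕ} {v : V} (hm : v ∈ T.chiIter m {T.root})
    (hn : v ∈ T.chiIter n {T.root}) : m = n := by
  induction m generalizing n v with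
  | zero =>
    obtain rfl : v = T.root := hm
    cases n with
    | zero => rfl
    | succ n =>
      obtain ⟨w, -, hw⟩ := hn
      exact absurd hw (T.root_no_parent w)
  | succ m ih =>
    obtain ⟨u, hu, huv⟩ := hm
    cases n with
    | zero =>
      obtain rfl : v = T.root := hn
      exact absurd huv (T.root_no_parent u)
    | succ n =>
      obtain ⟨w, hw, hwv⟩ := hn
      obtain rfl := T.uniq_parent huv hwv
      rw [ih hu hw]

theorem depth_eq_iff {v : V} {n : ℕ} : T.depth v = n ↔ v ∈ T.chiIter n {T.root} := by
  have h : v ∈ T.chiIter (T.depth v) {T.root} := Nat.sInf_mem (T.exists_mem_chiIter v)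
  exact ⟨fun e => e ▸ h, fun h' => T.chiIter_unique h h'⟩

theorem depth_of_edge {v u : V} (h : T.edge v u) : T.depth u = T.depth v + 1 :=
  T.depth_eq_iff.2 ⟨v, T.depth_eq_iff.1 rfl, h⟩

variable {T} (hT : T.LocFin)

theorem mem_chiFin {v u : V} : u ∈ T.chiFin hT v ↔ T.edge v u := by
  simp [chiFin, chi]

theorem chiFin_card_pos (hL : T.Leafless) (v : V) : 0 < (T.chiFin hT v).card := by
  obtain ⟨u, hu⟩ := hL v
  exact Finset.card_pos.2 ⟨u, (mem_chiFin hT).2 hu⟩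

theorem disjoint_chiFin {v w : V} (h : v ≠ w) :
    Disjoint (T.chiFin hT v) (T.chiFin hT w) := by
  rw [Finset.disjoint_left]
  intro u hv hw
  exact h (T.uniq_parent ((mem_chiFin hT).1 hv) ((mem_chiFin hT).1 hw))

open Classical in
/-- The finset of vertices of depth `n`. -/
def level (hT : T.LocFin) : ℕ → Finset V
  | 0 => {T.root}
  | n + 1 => (level hT n).biUnion (T.chiFin hT)

theorem mem_level {n : ℕ} {v : V} : v ∈ level hT n ↔ T.depth v = n := by
  rw [depth_eq_iff]
  induction n generalizing v with
  | zero => simp [level, chiIter]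
  | succ n ih => simp [level, chiIter, ih, mem_chiFin]

theorem card_level_zero : (level hT 0).card = 1 := Finset.card_singleton _

theorem card_level_succ (hL : T.Leafless) (n : ℕ) :
    (level hT (n + 1)).card =
      (level hT n).card + ∑ v ∈ level hT n, ((T.chiFin hT v).card - 1) := by
  classical
  rw [level, Finset.card_biUnion fun v _ w _ h => disjoint_chiFin hT h, Finset.card_eq_sum_ones,
    ← Finset.sum_add_distrib]
  refine Finset.sum_congr rfl fun v _ => ?_
  have := chiFin_card_pos hT hL v
  omega

theorem tsum_branching (n : ℕ) :
    (∑' v : {v : V // 2 ≤ (T.chiFin hT v).card ∧ T.depth v = n},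
      (((T.chiFin hT v.1).card - 1 : ℕ) : ℝ≥0∞)) =
      ((∑ v ∈ level hT n, ((T.chiFin hT v).card - 1) : ℕ) : ℝ≥0∞) := by
  classical
  have h := tsum_subtype {v : V | 2 ≤ (T.chiFin hT v).card ∧ T.depth v = n}
    (fun v => (((T.chiFin hT v).card - 1 : ℕ) : ℝ≥0∞))
  refine h.trans ?_
  rw [tsum_eq_sum (s := level hT n), Nat.cast_sum]
  · refine Finset.sum_congr rfl fun v hv => ?_
    rw [mem_level] at hv
    by_cases h2 : 2 ≤ (T.chiFin hT v).card
    · simp [Set.indicator, h2, hv]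
    · have : (T.chiFin hT v).card - 1 = 0 := by omega
      simp [Set.indicator, this]
  · intro v hv
    rw [mem_level] at hv
    simp [Set.indicator, hv]

/-- The branching sums determine, and are determined by, the cardinalities of the levels. -/
theorem tsum_branching_eq_iff {V' : Type} {T' : DirTree V'} (hT' : T'.LocFin)
    (hL : T.Leafless) (hL' : T'.Leafless) :
    (∀ n : ℕ,
      (∑' v : {v : V // 2 ≤ (T.chiFin hT v).card ∧ T.depth v = n},
          (((T.chiFin hT v.1).card - 1 : ℕ) : ℝ≥0∞)) =
        ∑' v : {v : V' // 2 ≤ (T'.chiFin hT' v).card ∧ T'.depth v = n},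
          (((T'.chiFin hT' v.1).card - 1 : ℕ) : ℝ≥0∞)) ↔
      ∀ n, (level hT n).card = (level hT' n).card := by
  simp only [tsum_branching, Nat.cast_inj]
  constructor
  · intro h n
    induction n with
    | zero => rw [card_level_zero, card_level_zero]
    | succ n ih => rw [card_level_succ hT hL, card_level_succ hT' hL', ih, h]
  · intro h n
    have h1 := h (n + 1)
    rw [card_level_succ hT hL, card_level_succ hT' hL', h n] at h1
    omega

end DirTree

/-! ### The standard basis of `ℓ²(V)` -/

theorem evec_apply_self {V : Type} (v : V) : (evec v : l2 V) v = 1 := by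
  classical
  simp [evec]

theorem evec_apply_ne {V : Type} {v w : V} (h : w ≠ v) : (evec v : l2 V) w = 0 := by
  simp [evec, h]

theorem inner_evec_left {V : Type} (v : V) (f : l2 V) : ⟪evec v, f⟫_ℂ = f v := by
  classical
  simp [evec, lp.inner_single_left]

theorem orthonormal_evec (V : Type) : Orthonormal ℂ (evec : V → l2 V) := by
  classical
  rw [orthonormal_iff_ite]
  intro v w
  rw [inner_evec_left]
  split_ifs with h
  · rw [h, evec_apply_self]
  · exact evec_apply_ne h

theorem l2_clm_ext {V : Type} {F : Type*} [AddCommMonoid F] [Module ℂ F] [TopologicalSpace F]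
    [T2Space F] {A B : l2 V →L[ℂ] F} (h : ∀ v, A (evec v) = B (evec v)) : A = B := by
  classical
  refine lp.ext_continuousLinearMap (by simp) fun v => ?_
  ext
  simpa [evec] using h v

namespace DirTree

variable {V : Type} {T : DirTree V} (hT : T.LocFin)

/-! ### The action of the Dirichlet shift on levels -/

/-- The factor by which the Dirichlet shift scales norms on the `n`-th level. -/
def scale (q : ℝ) (n : ℕ) : ℝ := Real.sqrt ((n + q) / (n + 1))

theorem scale_pos {q : ℝ} (hq : 1 < q) (n : ℕ) : 0 < scale q n := by
  unfold scale
  positivity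

theorem scale_sq {q : ℝ} (hq : 1 < q) (n : ℕ) : scale q n ^ 2 = (n + q) / (n + 1) :=
  Real.sq_sqrt (by positivity)

theorem scale_sq_injective {q : ℝ} (hq : 1 < q) : Function.Injective fun n => scale q n ^ 2 := by
  intro m n h
  simp only [scale_sq hq] at h
  rw [div_eq_div_iff (by positivity) (by positivity)] at h
  have h' : (q - 1) * ((m : ℝ) - n) = 0 := by linarith
  rcases mul_eq_zero.1 h' with h' | h'
  · linarith
  · exact_mod_cast sub_eq_zero.1 h'

theorem inner_shift_evec_left (hL : T.Leafless) {q : ℝ} {S : l2 V →L[ℂ] l2 V}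
    (hS : T.IsDirichletShift hT q S) (v : V) (f : l2 V) :
    ⟪S (evec v), S f⟫_ℂ = ((scale q (T.depth v) ^ 2 : ℝ) : ℂ) * f v := by
  suffices h : (innerSL ℂ (S (evec v))).comp S =
      ((scale q (T.depth v) ^ 2 : ℝ) : ℂ) • innerSL ℂ (evec v) by
    simpa [inner_evec_left] using congrArg (fun A => A f) h
  refine l2_clm_ext fun w => ?_
  classical
  have key : ⟪S (evec v), S (evec w)⟫_ℂ =
      ((scale q (T.depth v) ^ 2 : ℝ) : ℂ) * ⟪(evec v : l2 V), evec w⟫_ℂ := by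
    simp only [hS v, hS w, sum_inner, inner_sum, inner_smul_left, inner_smul_right,
      orthonormal_iff_ite.1 (orthonormal_evec V)]
    by_cases h : v = w
    · subst h
      have hc : (0 : ℝ) < (T.chiFin hT v).card := by exact_mod_cast chiFin_card_pos hT hL v
      have hw : (T.chiFin hT v).card * (T.wt hT q v * T.wt hT q v) =
          scale q (T.depth v) ^ 2 := by
        rw [← sq, wt, div_pow, Real.sq_sqrt hc.le, scale]
        field_simp
      have hw' := congrArg ((↑) : ℝ → ℂ) hw
      push_cast at hw'
      simp [hw']
    · have hd := Finset.disjoint_left.1 (disjoint_chiFin hT h)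
      rw [if_neg h, mul_zero]
      refine Finset.sum_eq_zero fun u hu => ?_
      rw [Finset.sum_eq_zero fun x hx => ?_, mul_zero]
      have hxu : x ≠ u := fun e => hd hx (e ▸ hu)
      rw [if_neg hxu, mul_zero]
  simpa using key

/-- The span of the basis vectors at depth `n`. -/
def levelSpace (hT : T.LocFin) (n : ℕ) : Submodule ℂ (l2 V) :=
  Submodule.span ℂ (Set.range fun v : level hT n => (evec v.1 : l2 V))

instance finiteDimensional_levelSpace (n : ℕ) : FiniteDimensional ℂ (levelSpace hT n) :=
  FiniteDimensional.span_of_finite ℂ (Set.finite_range _)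

theorem finrank_levelSpace (n : ℕ) :
    Module.finrank ℂ (levelSpace hT n) = (level hT n).card := by
  have h := (orthonormal_evec V).linearIndependent.comp
    (Subtype.val : level hT n → V) Subtype.val_injective
  exact (finrank_span_eq_card h).trans (Fintype.card_coe _)

theorem evec_mem_levelSpace (v : V) : (evec v : l2 V) ∈ levelSpace hT (T.depth v) :=
  Submodule.subset_span ⟨⟨v, (mem_level hT).2 rfl⟩, rfl⟩

theorem mem_levelSpace {n : ℕ} {f : l2 V} :
    f ∈ levelSpace hT n ↔ ∀ v, T.depth v ≠ n → f v = 0 := by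
  classical
  constructor
  · intro hf v hv
    induction hf using Submodule.span_induction with
    | mem x hx =>
      obtain ⟨⟨w, hw⟩, rfl⟩ := hx
      refine evec_apply_ne ?_
      rintro rfl
      exact hv ((mem_level hT).1 hw)
    | zero => rfl
    | add x y _ _ hx hy => simp [hx, hy]
    | smul a x _ hx => simp [hx]
  · intro h
    have hf : f = ∑ v ∈ level hT n, f v • evec v := by
      ext w
      have hw : ∀ v, (f v • (evec v : l2 V)) w = if v = w then f w else 0 := by
        intro v
        split_ifs with e
        · subst e
          simp [evec_apply_self]
        · simp [evec_apply_ne (Ne.symm e)]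
      rw [lp.coeFn_sum, Finset.sum_apply, Finset.sum_congr rfl fun v _ => hw v,
        Finset.sum_ite_eq']
      split_ifs with e
      · rfl
      · exact h w fun e' => e ((mem_level hT).2 e')
    rw [hf]
    refine Submodule.sum_mem _ fun v hv => Submodule.smul_mem _ _ ?_
    exact Submodule.subset_span ⟨⟨v, hv⟩, rfl⟩

theorem inner_eq_zero_of_mem_levelSpace {m n : ℕ} (h : m ≠ n) {f g : l2 V}
    (hf : f ∈ levelSpace hT m) (hg : g ∈ levelSpace hT n) : ⟪f, g⟫_ℂ = 0 := by
  rw [lp.inner_eq_tsum]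
  refine (tsum_congr fun v => ?_).trans tsum_zero
  by_cases hv : T.depth v = m
  · rw [(mem_levelSpace hT).1 hg v (hv ▸ h), inner_zero_right]
  · rw [(mem_levelSpace hT).1 hf v hv, inner_zero_left]

theorem shift_mem_levelSpace {q : ℝ} {S : l2 V →L[ℂ] l2 V} (hS : T.IsDirichletShift hT q S)
    {n : ℕ} {f : l2 V} (hf : f ∈ levelSpace hT n) : S f ∈ levelSpace hT (n + 1) := by
  induction hf using Submodule.span_induction with
  | mem x hx =>
    obtain ⟨⟨v, hv⟩, rfl⟩ := hx
    simp only [hS v]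
    refine Submodule.sum_mem _ fun u hu => Submodule.smul_mem _ _ ?_
    rw [← (mem_level hT).1 hv, ← T.depth_of_edge ((mem_chiFin hT).1 hu)]
    exact evec_mem_levelSpace hT u
  | zero => simp
  | add x y _ _ hx hy => simpa using Submodule.add_mem _ hx hy
  | smul a x _ hx => simpa using Submodule.smul_mem _ a hx

theorem inner_shift_of_mem_levelSpace (hL : T.Leafless) {q : ℝ} {S : l2 V →L[ℂ] l2 V}
    (hS : T.IsDirichletShift hT q S) {n : ℕ} {f : l2 V} (hf : f ∈ levelSpace hT n) (g : l2 V) :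
    ⟪S f, S g⟫_ℂ = ((scale q n ^ 2 : ℝ) : ℂ) * ⟪f, g⟫_ℂ := by
  induction hf using Submodule.span_induction with
  | mem x hx =>
    obtain ⟨⟨v, hv⟩, rfl⟩ := hx
    simp only [inner_shift_evec_left hT hL hS, inner_evec_left, (mem_level hT).1 hv]
  | zero => simp
  | add x y _ _ hx hy => rw [map_add, inner_add_left, hx, hy, inner_add_left, mul_add]
  | smul a x _ hx => rw [map_smul, inner_smul_left, hx, inner_smul_left, mul_left_comm]

/-- The level spaces are the eigenspaces of `S* S`. -/
theorem mem_levelSpace_iff_inner_shift (hL : T.Leafless) {q : ℝ} (hq : 1 < q)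
    {S : l2 V →L[ℂ] l2 V} (hS : T.IsDirichletShift hT q S) {n : ℕ} {f : l2 V} :
    f ∈ levelSpace hT n ↔
      ∀ g, ⟪S g, S f⟫_ℂ = ((scale q n ^ 2 : ℝ) : ℂ) * ⟪g, f⟫_ℂ := by
  constructor
  · intro hf g
    rw [← inner_conj_symm, inner_shift_of_mem_levelSpace hT hL hS hf, map_mul, Complex.conj_ofReal,
      inner_conj_symm]
  · intro h
    refine (mem_levelSpace hT).2 fun v hv => ?_
    have h1 := h (evec v)
    rw [inner_shift_evec_left hT hL hS, inner_evec_left] at h1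
    by_contra h0
    exact hv (scale_sq_injective hq (Complex.ofReal_injective (mul_right_cancel₀ h0 h1)))

/-! ### Unitary equivalence -/

theorem card_level_eq_of_intertwining {V' : Type} {T' : DirTree V'} (hT' : T'.LocFin)
    (hL : T.Leafless) (hL' : T'.Leafless) {q : ℝ} (hq : 1 < q)
    {S : l2 V →L[ℂ] l2 V} (hS : T.IsDirichletShift hT q S)
    {S' : l2 V' →L[ℂ] l2 V'} (hS' : T'.IsDirichletShift hT' q S')
    (U : l2 V ≃ₗᵢ[ℂ] l2 V') (hU : ∀ f, U (S f) = S' (U f)) (n : ℕ) :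
    (level hT n).card = (level hT' n).card := by
  have hmap : (levelSpace hT n).map (U.toLinearEquiv : l2 V →ₗ[ℂ] l2 V') = levelSpace hT' n := by
    ext f
    obtain ⟨f, rfl⟩ := U.surjective f
    have hmem : U f ∈ (levelSpace hT n).map (U.toLinearEquiv : l2 V →ₗ[ℂ] l2 V') ↔
        f ∈ levelSpace hT n :=
      ⟨fun ⟨g, hg, e⟩ => U.injective e ▸ hg, fun h => ⟨f, h, rfl⟩⟩
    rw [hmem, mem_levelSpace_iff_inner_shift hT hL hq hS,
      mem_levelSpace_iff_inner_shift hT' hL' hq hS', U.surjective.forall]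
    simp only [← hU, U.inner_map_map]
  rw [← finrank_levelSpace, ← finrank_levelSpace, ← hmap]
  exact (LinearEquiv.finrank_map_eq U.toLinearEquiv _).symm

theorem exists_orthonormalBasis_levelSpace_succ (hL : T.Leafless) {q : ℝ} (hq : 1 < q)
    {S : l2 V →L[ℂ] l2 V} (hS : T.IsDirichletShift hT q S) {n k m : ℕ} (hkm : k ≤ m)
    (hm : (level hT (n + 1)).card = m) (B : OrthonormalBasis (Fin k) ℂ (levelSpace hT n)) :
    ∃ B' : OrthonormalBasis (Fin m) ℂ (levelSpace hT (n + 1)),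
      ∀ i, S (B i) = (scale q n : ℂ) • (B' (Fin.castLE hkm i) : l2 V) := by
  have hc : (scale q n : ℂ) ≠ 0 := by exact_mod_cast (scale_pos hq n).ne'
  let x : Fin k → levelSpace hT (n + 1) := fun i =>
    ⟨(scale q n : ℂ)⁻¹ • S (B i),
      Submodule.smul_mem _ _ (shift_mem_levelSpace hT hS (B i).2)⟩
  have hx : Orthonormal ℂ x := by
    rw [orthonormal_iff_ite]
    intro i j
    have hB : ⟪(B i : l2 V), B j⟫_ℂ = if i = j then 1 else 0 :=
      orthonormal_iff_ite.1 B.orthonormal i j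
    simp only [x, Submodule.coe_inner, inner_smul_left, inner_smul_right,
      inner_shift_of_mem_levelSpace hT hL hS (B i).2, hB, map_inv₀, Complex.conj_ofReal]
    push_cast
    field_simp
  let y : Fin m → levelSpace hT (n + 1) := fun j => if h : j.1 < k then x ⟨j, h⟩ else 0
  have hy : Orthonormal ℂ (Set.domRestrict {j : Fin m | j.1 < k} y) := by
    have : Set.domRestrict {j : Fin m | j.1 < k} y = x ∘ fun j => ⟨j.1.1, j.2⟩ := by
      funext j
      exact dif_pos j.2
    rw [this]
    refine hx.comp _ fun a b e => ?_
    exact Subtype.ext (Fin.ext (Fin.mk.inj_iff.1 e))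
  obtain ⟨B', hB'⟩ := hy.exists_orthonormalBasis_extension_of_card_eq
    (by rw [finrank_levelSpace, hm, Fintype.card_fin])
  refine ⟨B', fun i => ?_⟩
  have hi : B' (Fin.castLE hkm i) = x i := (hB' _ i.2).trans (dif_pos i.2)
  rw [hi, smul_inv_smul₀ hc]

/-- A Hilbert basis adapted to the levels, on which the shift acts as a weighted translation. -/
theorem exists_hilbertBasis_shift (hL : T.Leafless) {q : ℝ} (hq : 1 < q)
    {S : l2 V →L[ℂ] l2 V} (hS : T.IsDirichletShift hT q S) {N : ℕ → ℕ}
    (hN : ∀ n, (level hT n).card = N n) (hmono : ∀ n, N n ≤ N (n + 1)) :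
    ∃ b : HilbertBasis (Σ n, Fin (N n)) ℂ (l2 V),
      ∀ n i, S (b ⟨n, i⟩) = (scale q n : ℂ) • b ⟨n + 1, Fin.castLE (hmono n) i⟩ := by
  choose next hnext using fun n =>
    exists_orthonormalBasis_levelSpace_succ hT hL hq hS (hmono n) (hN (n + 1))
  let B₀ : OrthonormalBasis (Fin (N 0)) ℂ (levelSpace hT 0) :=
    (stdOrthonormalBasis ℂ (levelSpace hT 0)).reindex
      (finCongr ((finrank_levelSpace hT 0).trans (hN 0)))
  let B : ∀ n, OrthonormalBasis (Fin (N n)) ℂ (levelSpace hT n) :=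
    fun n => Nat.rec B₀ next n
  let b : (Σ n, Fin (N n)) → l2 V := fun p => B p.1 p.2
  have hb : Orthonormal ℂ b := by
    refine ⟨fun p => (B p.1).orthonormal.1 p.2, ?_⟩
    rintro ⟨m, i⟩ ⟨n, j⟩ h
    by_cases hmn : m = n
    · subst hmn
      exact (B m).orthonormal.2 fun e => h (congrArg (Sigma.mk m) e)
    · exact inner_eq_zero_of_mem_levelSpace hT hmn (B m i).2 (B n j).2
  have hspan : (Submodule.span ℂ (Set.range b))ᗮ = ⊥ := by
    rw [Submodule.eq_bot_iff]
    intro f hf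
    ext v
    rw [← inner_evec_left v f]
    refine (Submodule.mem_orthogonal _ f).1 hf _ ?_
    have hsum := congrArg Subtype.val
      ((B (T.depth v)).sum_repr ⟨evec v, evec_mem_levelSpace hT v⟩)
    rw [Submodule.coe_sum] at hsum
    change _ = (evec v : l2 V) at hsum
    rw [← hsum]
    exact Submodule.sum_mem _ fun i _ =>
      Submodule.smul_mem _ _ (Submodule.subset_span ⟨⟨_, i⟩, rfl⟩)
  refine ⟨HilbertBasis.mkOfOrthogonalEqBot hb hspan, fun n i => ?_⟩
  rw [HilbertBasis.coe_mkOfOrthogonalEqBot]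
  exact hnext n (B n) i

theorem exists_intertwining_of_card_level_eq {V' : Type} {T' : DirTree V'} (hT' : T'.LocFin)
    (hL : T.Leafless) (hL' : T'.Leafless) {q : ℝ} (hq : 1 < q)
    {S : l2 V →L[ℂ] l2 V} (hS : T.IsDirichletShift hT q S)
    {S' : l2 V' →L[ℂ] l2 V'} (hS' : T'.IsDirichletShift hT' q S')
    (h : ∀ n, (level hT n).card = (level hT' n).card) :
    ∃ U : l2 V ≃ₗᵢ[ℂ] l2 V', ∀ f, U (S f) = S' (U f) := by
  classical
  have hmono : ∀ n, (level hT n).card ≤ (level hT (n + 1)).card := fun n =>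
    (card_level_succ hT hL n) ▸ Nat.le_add_right _ _
  obtain ⟨b, hb⟩ := exists_hilbertBasis_shift hT hL hq hS (fun _ => rfl) hmono
  obtain ⟨b', hb'⟩ := exists_hilbertBasis_shift hT' hL' hq hS' (fun n => (h n).symm) hmono
  let U : l2 V ≃ₗᵢ[ℂ] l2 V' := b.repr.trans b'.repr.symm
  have hU : ∀ p, U (b p) = b' p := fun p => by
    simp [U, b.repr_self, b'.repr_symm_single]
  refine ⟨U, fun f => ?_⟩
  have hdense : Dense (Submodule.span ℂ (Set.range b) : Set (l2 V)) :=
    Submodule.dense_iff_topologicalClosure_eq_top.2 b.dense_span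
  have hext : (U.toContinuousLinearEquiv : l2 V →L[ℂ] l2 V').comp S =
      S'.comp (U.toContinuousLinearEquiv : l2 V →L[ℂ] l2 V') := by
    refine ContinuousLinearMap.ext_on hdense ?_
    rintro _ ⟨⟨n, i⟩, rfl⟩
    change U (S (b ⟨n, i⟩)) = S' (U (b ⟨n, i⟩))
    rw [hb, map_smul, hU, hU, hb']
  exact congrArg (fun A => A f) hext

end DirTree

theorem stmt_15 (q : ℕ) (hq : 2 ≤ q)
    {V₁ V₂ : Type} [Countable V₁] [Infinite V₁] [Countable V₂] [Infinite V₂]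
    (T₁ : DirTree V₁) (hL₁ : T₁.Leafless) (hT₁ : T₁.LocFin)
    (T₂ : DirTree V₂) (hL₂ : T₂.Leafless) (hT₂ : T₂.LocFin)
    (S₁ : l2 V₁ →L[ℂ] l2 V₁) (hS₁ : T₁.IsDirichletShift hT₁ (q : ℝ) S₁)
    (S₂ : l2 V₂ →L[ℂ] l2 V₂) (hS₂ : T₂.IsDirichletShift hT₂ (q : ℝ) S₂) :
    (∃ U : l2 V₁ ≃ₗᵢ[ℂ] l2 V₂, ∀ f : l2 V₁, U (S₁ f) = S₂ (U f)) ↔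
      ∀ n : ℕ,
        (∑' v : {v : V₁ // 2 ≤ (T₁.chiFin hT₁ v).card ∧ T₁.depth v = n},
            (((T₁.chiFin hT₁ v.1).card - 1 : ℕ) : ℝ≥0∞)) =
          ∑' v : {v : V₂ // 2 ≤ (T₂.chiFin hT₂ v).card ∧ T₂.depth v = n},
            (((T₂.chiFin hT₂ v.1).card - 1 : ℕ) : ℝ≥0∞) := by
  have hq' : (1 : ℝ) < q := by exact_mod_cast hq
  rw [DirTree.tsum_branching_eq_iff hT₁ hT₂ hL₁ hL₂]
  constructor
  · rintro ⟨U, hU⟩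
    exact DirTree.card_level_eq_of_intertwining hT₁ hT₂ hL₁ hL₂ hq' hS₁ hS₂ U hU
  · exact DirTree.exists_intertwining_of_card_level_eq hT₁ hT₂ hL₁ hL₂ hq' hS₁ hS₂

end
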